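/- Let G(x) = A_0 + x_1 A_1 + ... + x_n A_n with A_0,...,A_n q×q symmetric real matrices, K = {x ∈ ℝ^n : G(x) ⪰ 0}, and suppose K is compact with nonempty interior. For f ∈ ℝ[x_1,...,x_n], let f* = min_{x ∈ K} f(x), and for each m ∈ ℕ let f*_m = sup{ r ∈ ℝ : f − r ∈ H_m(G) }, where H_m(G) is the set of polynomials of the form λ_0 + Σ_{k=1}^m ⟨Λ_k, G(x)^{⊗k}⟩ with λ_0 ≥ 0 real and each Λ_k a q^k × q^k positive semidefinite real matrix. Then the sequence (f*_m)_{m ∈ ℕ} is nondecreasing, f*_m ≤ f* for all m, and f*_m → f* as m → ∞. -/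

import Mathlib

open scoped BigOperators

noncomputable section

/-- The `k`-fold Kronecker power of a matrix, with rows and columns indexed by
functions `Fin k → ι` (a type of cardinality `(#ι)^k`):
`(M^{⊗k})_{a,b} = ∏ᵢ M_{a i, b i}`. -/
def kronPow {ι : Type*} {R : Type*} [CommMonoid R] (M : Matrix ι ι R) (k : ℕ) :
    Matrix (Fin k → ι) (Fin k → ι) R :=
  Matrix.of fun a b => ∏ i, M (a i) (b i)

/-- Trace inner product `⟨Λ, B⟩ = tr(Λᵀ B) = ∑ᵢⱼ Λᵢⱼ Bᵢⱼ` of a real matrix against a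
polynomial matrix. -/
def tipP {n : ℕ} {ι : Type*} [Fintype ι] (Λ : Matrix ι ι ℝ)
    (B : Matrix ι ι (MvPolynomial (Fin n) ℝ)) : MvPolynomial (Fin n) ℝ :=
  ∑ i, ∑ j, MvPolynomial.C (Λ i j) * B i j

/-- The truncation `H_m(G)`: polynomials `λ₀ + ∑_{k=1}^m ⟨Λ_k, G(x)^{⊗k}⟩` with
`λ₀ ≥ 0` and each `Λ_k` positive semidefinite. -/
def HsetT {n : ℕ} {ι : Type*} [Fintype ι]
    (G : Matrix ι ι (MvPolynomial (Fin n) ℝ)) (m : ℕ) : Set (MvPolynomial (Fin n) ℝ) :=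
  { p | ∃ (lam0 : ℝ) (Λ : (k : ℕ) → Matrix (Fin k → ι) (Fin k → ι) ℝ),
      0 ≤ lam0 ∧ (∀ k ∈ Finset.Icc 1 m, (Λ k).PosSemidef) ∧
      p = MvPolynomial.C lam0 + ∑ k ∈ Finset.Icc 1 m, tipP (Λ k) (kronPow G k) }

/-- The linear polynomial matrix `G(x) = A₀ + ∑ₗ xₗ Aₗ`. -/
def linMat {n q : ℕ} (A0 : Matrix (Fin q) (Fin q) ℝ)
    (A : Fin n → Matrix (Fin q) (Fin q) ℝ) :
    Matrix (Fin q) (Fin q) (MvPolynomial (Fin n) ℝ) :=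
  Matrix.of fun i j =>
    MvPolynomial.C (A0 i j) + ∑ l, MvPolynomial.X l * MvPolynomial.C (A l i j)

/-- Entrywise evaluation of a polynomial matrix at a point `x`. -/
def evalMat {n : ℕ} {ι : Type*} (x : Fin n → ℝ)
    (B : Matrix ι ι (MvPolynomial (Fin n) ℝ)) : Matrix ι ι ℝ :=
  Matrix.of fun i j => MvPolynomial.eval x (B i j)

/-- The states of a real algebra with respect to a subset `T`: linear functionals, as bare
functions, that are nonnegative on `T` and take the value `1` at `1`. -/
def stateSet {R : Type*} [CommRing R] [Algebra ℝ R] (T : Set R) : Set (R → ℝ) :=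
  {φ | (∀ x y, φ (x + y) = φ x + φ y) ∧ (∀ (c : ℝ) x, φ (c • x) = c * φ x) ∧
    (∀ t ∈ T, 0 ≤ φ t) ∧ φ 1 = 1}

section Archimedean

variable {R : Type*} [CommRing R] [Algebra ℝ R] {T : Subsemiring R}

theorem isCompact_stateSet (hT : ∀ x : R, ∃ N : ℝ, algebraMap ℝ R N + x ∈ T) :
    IsCompact (stateSet (T : Set R)) := by
  choose N hN using hT
  refine (isCompact_univ_pi fun x : R => isCompact_Icc (a := -N x) (b := N (-x))).of_isClosed_subset
    ?_ ?_
  · simp only [stateSet, Set.ofPred_and, Set.ofPred_forall]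
    refine IsClosed.inter ?_ (IsClosed.inter ?_ (IsClosed.inter ?_ ?_))
    · exact isClosed_iInter fun x => isClosed_iInter fun y =>
        isClosed_eq (by fun_prop) (by fun_prop)
    · exact isClosed_iInter fun x => isClosed_iInter fun y =>
        isClosed_eq (by fun_prop) (by fun_prop)
    · exact isClosed_iInter fun x => isClosed_iInter fun _ =>
        isClosed_le (by fun_prop) (by fun_prop)
    · exact isClosed_eq (by fun_prop) (by fun_prop)
  · rintro φ ⟨hadd, hsmul, hpos, hone⟩ x -
    have h1 := hpos _ (hN x)
    have h2 := hpos _ (hN (-x))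
    have h3 := hsmul (-1) x
    rw [neg_one_smul] at h3
    rw [hadd, Algebra.algebraMap_eq_smul_one, hsmul, hone] at h1 h2
    constructor <;> linarith

theorem exists_mem_stateSet_nonpos (hscal : ∀ r : ℝ, 0 ≤ r → algebraMap ℝ R r ∈ T)
    (hT : ∀ x : R, ∃ N : ℝ, algebraMap ℝ R N + x ∈ T) {p : R} (hp : p ∉ T) :
    ∃ φ ∈ stateSet (T : Set R), φ p ≤ 0 := by
  have hsm : ∀ (r : ℝ) (x : R), 0 ≤ r → x ∈ T → r • x ∈ T := fun r x hr hx => by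
    rw [Algebra.smul_def]
    exact T.mul_mem (hscal r hr) hx
  have hneg : ∀ a : ℝ, a < 0 → algebraMap ℝ R a ∉ T := fun a ha h => by
    obtain ⟨N, hN⟩ := hT p
    refine hp ?_
    have h1 : p = (algebraMap ℝ R N + p) + algebraMap ℝ R (|N| / -a) * algebraMap ℝ R a +
        algebraMap ℝ R (|N| - N) := by
      rw [← map_mul, div_mul_eq_mul_div, mul_div_assoc, div_neg, div_self ha.ne]
      simp only [map_mul, map_sub, map_neg, map_one]
      ring
    rw [h1]
    exact T.add_mem (T.add_mem hN (T.mul_mem (hscal _ (div_nonneg (abs_nonneg _) (by linarith))) h))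
      (hscal _ (sub_nonneg.2 (le_abs_self N)))
  have hone : (1 : R) ≠ 0 := fun h => hp <| by
    rw [← mul_one p, h, mul_zero]; exact T.zero_mem
  let s : PointedCone ℝ R :=
    { carrier := {x | ∃ t ∈ T, ∃ c : ℝ, 0 ≤ c ∧ x = t - c • p}
      add_mem' := by
        rintro _ _ ⟨t, ht, c, hc, rfl⟩ ⟨t', ht', c', hc', rfl⟩
        exact ⟨t + t', T.add_mem ht ht', c + c', add_nonneg hc hc', by rw [add_smul]; abel⟩
      zero_mem' := ⟨0, T.zero_mem, 0, le_rfl, by simp⟩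
      smul_mem' := by
        rintro ⟨r, hr⟩ _ ⟨t, ht, c, hc, rfl⟩
        exact ⟨r • t, hsm r t hr ht, r * c, mul_nonneg hr hc, by
          change r • (t - c • p) = _
          rw [smul_sub, smul_smul]⟩ }
  obtain ⟨g, hg, hgs⟩ := riesz_extension s (LinearPMap.mkSpanSingleton (1 : R) (1 : ℝ) hone) (by
      rintro ⟨x, hx⟩ hxs
      obtain ⟨a, rfl⟩ := Submodule.mem_span_singleton.1 hx
      rw [LinearPMap.mkSpanSingleton'_apply]
      obtain ⟨t, ht, c, hc, h⟩ := hxs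
      simp only [RingHom.id_apply, smul_eq_mul, mul_one]
      by_contra! ha
      change a • (1 : R) = _ at h
      rw [← Algebra.algebraMap_eq_smul_one] at h
      rcases hc.eq_or_lt with rfl | hc
      · rw [zero_smul, sub_zero] at h
        exact hneg a ha (h ▸ ht)
      · refine hp ?_
        have : p = c⁻¹ • (t + algebraMap ℝ R (-a)) := by
          rw [map_neg, h, eq_inv_smul_iff₀ hc.ne']
          abel
        rw [this]
        exact hsm _ _ (inv_nonneg.2 hc.le) (T.add_mem ht (hscal _ (by linarith))))
    (by
      intro y
      obtain ⟨N, hN⟩ := hT y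
      refine ⟨⟨N • 1, Submodule.mem_span_singleton.2 ⟨N, rfl⟩⟩, _, hN, 0, le_rfl, ?_⟩
      rw [zero_smul, sub_zero, Algebra.algebraMap_eq_smul_one])
  refine ⟨g, ⟨map_add g, fun c x => by simp, fun t ht => hgs _ ⟨t, ht, 0, le_rfl, by simp⟩, ?_⟩, ?_⟩
  · have := hg ⟨1, Submodule.mem_span_singleton_self 1⟩
    rw [this]
    exact LinearPMap.mkSpanSingleton_apply ℝ ℝ hone (1 : ℝ)
  · have := hgs (-p) ⟨0, T.zero_mem, 1, zero_le_one, by simp⟩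
    rw [map_neg] at this
    linarith

theorem map_mul_of_mem_extremePoints_stateSet
    (hT : ∀ x : R, ∃ N : ℝ, algebraMap ℝ R N + x ∈ T) {φ : R → ℝ}
    (hφ : φ ∈ (stateSet (T : Set R)).extremePoints ℝ) (x y : R) : φ (x * y) = φ x * φ y := by
  obtain ⟨⟨hadd, hsmul, hpos, hone⟩, hext⟩ := hφ
  have halg : ∀ r : ℝ, φ (algebraMap ℝ R r) = r := fun r => by
    rw [Algebra.algebraMap_eq_smul_one, hsmul, hone, mul_one]
  have hmem : ∀ u ∈ T, 0 < φ u → (fun z => (φ u)⁻¹ * φ (u * z)) ∈ stateSet (T : Set R) := by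
    intro u hu h
    refine ⟨fun a b => ?_, fun c a => ?_, fun t ht => ?_, ?_⟩
    · simp only [mul_add, hadd]
    · simp only [mul_smul_comm, hsmul]; ring
    · exact mul_nonneg (inv_nonneg.2 h.le) (hpos _ (T.mul_mem hu ht))
    · simp only [mul_one]
      exact inv_mul_cancel₀ h.ne'
  have hbig : ∀ z : R, ∃ N : ℝ, algebraMap ℝ R N + z ∈ T ∧ 0 < φ (algebraMap ℝ R N + z) := by
    intro z
    obtain ⟨N, hN⟩ := hT z
    have h : algebraMap ℝ R (N + 1) + z = (algebraMap ℝ R N + z) + 1 := by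
      rw [map_add, map_one]; ring
    refine ⟨N + 1, h ▸ T.add_mem hN T.one_mem, ?_⟩
    rw [h, hadd, hone]
    linarith [hpos _ hN]
  obtain ⟨N, hN, hNpos⟩ := hbig x
  obtain ⟨M, hM, hMpos⟩ := hbig (-x)
  set u := algebraMap ℝ R N + x with hu
  set w := algebraMap ℝ R M + -x with hw
  have huw : u + w = algebraMap ℝ R (N + M) := by rw [map_add]; ring
  have hsum : φ u + φ w = N + M := by rw [← hadd, huw, halg]
  have hD : 0 < φ u + φ w := add_pos hNpos hMpos
  have hseg : φ ∈ openSegment ℝ (fun z => (φ u)⁻¹ * φ (u * z)) (fun z => (φ w)⁻¹ * φ (w * z)) := by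
    refine ⟨φ u / (φ u + φ w), φ w / (φ u + φ w), div_pos hNpos hD, div_pos hMpos hD, ?_, ?_⟩
    · rw [← add_div, div_self hD.ne']
    · funext z
      have h : φ (u * z) + φ (w * z) = (φ u + φ w) * φ z := by
        rw [← hadd, ← add_mul, huw, hsum, ← Algebra.smul_def, hsmul]
      simp only [Pi.add_apply, Pi.smul_apply, smul_eq_mul]
      field_simp
      linarith
  have h := congrFun (hext (hmem u hN hNpos) (hmem w hM hMpos) hseg) y
  rw [inv_mul_eq_iff_eq_mul₀ hNpos.ne', hu, add_mul, hadd, hadd, halg, ← Algebra.smul_def, hsmul]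
    at h
  linarith

/-- **Representation theorem for Archimedean semirings** (Krivine, Kadison, Dubois). -/
theorem add_algebraMap_mem_of_forall_algHom_nonneg
    (hscal : ∀ r : ℝ, 0 ≤ r → algebraMap ℝ R r ∈ T)
    (hT : ∀ x : R, ∃ N : ℝ, algebraMap ℝ R N + x ∈ T) {p : R}
    (hp : ∀ χ : R →ₐ[ℝ] ℝ, (∀ t ∈ T, 0 ≤ χ t) → 0 ≤ χ p) {ε : ℝ} (hε : 0 < ε) :
    p + algebraMap ℝ R ε ∈ T := by
  by_contra hmem
  obtain ⟨ψ, hψ, hψp⟩ := exists_mem_stateSet_nonpos hscal hT hmem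
  have hcomp := isCompact_stateSet hT
  obtain ⟨φ₀, hφ₀, hmin⟩ := hcomp.exists_isMinOn ⟨ψ, hψ⟩ (continuous_apply p).continuousOn
  let B : Set (R → ℝ) := {φ ∈ stateSet (T : Set R) | ∀ φ' ∈ stateSet (T : Set R),
    (-ContinuousLinearMap.proj p : StrongDual ℝ (R → ℝ)) φ' ≤
      (-ContinuousLinearMap.proj p : StrongDual ℝ (R → ℝ)) φ}
  have hB : IsExposed ℝ (stateSet (T : Set R)) B := fun _ => ⟨_, rfl⟩
  have hBne : B.Nonempty := ⟨φ₀, hφ₀, fun φ' hφ' => neg_le_neg (hmin hφ')⟩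
  obtain ⟨φ, hφB⟩ := (hB.isCompact hcomp).extremePoints_nonempty hBne
  have hφ := hB.isExtreme.extremePoints_subset_extremePoints hφB
  have hmul := map_mul_of_mem_extremePoints_stateSet hT hφ
  have hle : φ p ≤ ψ p := neg_le_neg_iff.1 (hφB.1.2 ψ hψ)
  obtain ⟨hadd, hsmul, hpos, hone⟩ := hφ.1
  let χ : R →ₐ[ℝ] ℝ := AlgHom.ofLinearMap
    { toFun := φ, map_add' := hadd, map_smul' := hsmul } hone hmul
  have h : 0 ≤ φ p := hp χ hpos
  obtain ⟨hadd', hsmul', -, hone'⟩ := hψ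
  rw [hadd', Algebra.algebraMap_eq_smul_one, hsmul', hone'] at hψp
  linarith

/-- A semiring is Archimedean as soon as it bounds a set of algebra generators on both sides. -/
theorem exists_algebraMap_add_mem_of_adjoin_eq_top
    (hscal : ∀ r : ℝ, 0 ≤ r → algebraMap ℝ R r ∈ T) {s : Set R} (hs : Algebra.adjoin ℝ s = ⊤)
    (hsT : ∀ x ∈ s, ∃ N : ℝ, algebraMap ℝ R N + x ∈ T ∧ algebraMap ℝ R N - x ∈ T) (x : R) :
    ∃ N : ℝ, algebraMap ℝ R N + x ∈ T := by
  suffices h : ∃ N : ℝ, algebraMap ℝ R N + x ∈ T ∧ algebraMap ℝ R N - x ∈ T from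
    h.imp fun _ => And.left
  have hx : x ∈ Algebra.adjoin ℝ s := hs ▸ Algebra.mem_top
  induction hx using Algebra.adjoin_induction with
  | mem x hx => exact hsT x hx
  | algebraMap r =>
    refine ⟨|r|, ?_, ?_⟩
    · rw [← map_add]; exact hscal _ (by linarith [neg_abs_le r])
    · rw [← map_sub]; exact hscal _ (by linarith [le_abs_self r])
  | add x y _ _ hx hy =>
    obtain ⟨N, h1, h2⟩ := hx
    obtain ⟨M, h3, h4⟩ := hy
    refine ⟨N + M, ?_, ?_⟩
    · convert T.add_mem h1 h3 using 1; rw [map_add]; ring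
    · convert T.add_mem h2 h4 using 1; rw [map_add]; ring
  | mul x y _ _ hx hy =>
    obtain ⟨N, h1, h2⟩ := hx
    obtain ⟨M, h3, h4⟩ := hy
    have half : algebraMap ℝ R (1 / 2) * 2 = 1 := by
      rw [← map_ofNat (algebraMap ℝ R) 2, ← map_mul]; norm_num
    refine ⟨N * M, ?_, ?_⟩
    · convert T.mul_mem (hscal (1 / 2) (by norm_num))
        (T.add_mem (T.mul_mem h1 h3) (T.mul_mem h2 h4)) using 1
      rw [map_mul]
      linear_combination (-(algebraMap ℝ R N * algebraMap ℝ R M + x * y)) * half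
    · convert T.mul_mem (hscal (1 / 2) (by norm_num))
        (T.add_mem (T.mul_mem h1 h4) (T.mul_mem h2 h3)) using 1
      rw [map_mul]
      linear_combination (-(algebraMap ℝ R N * algebraMap ℝ R M - x * y)) * half

end Archimedean

/-- A point of a finite-dimensional convex cone on which every nonzero functional of the dual cone
is nonzero is an order unit. -/
theorem exists_smul_add_mem_of_forall_eq_zero {V : Type*} [NormedAddCommGroup V] [NormedSpace ℝ V]
    [FiniteDimensional ℝ V] (C : PointedCone ℝ V) {e : V} (he : e ∈ C)
    (h : ∀ φ : V →ₗ[ℝ] ℝ, (∀ c ∈ C, 0 ≤ φ c) → φ e = 0 → φ = 0) (v : V) :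
    ∃ N : ℝ, N • e + v ∈ C := by
  have hconv : Convex ℝ (C : Set V) := C.convex
  have hspan : Submodule.span ℝ (C : Set V) = ⊤ := by
    by_contra hne
    obtain ⟨φ, hφ, hle⟩ := Submodule.exists_le_ker_of_lt_top _ (lt_top_iff_ne_top.2 hne)
    have hker : ∀ c ∈ C, φ c = 0 := fun c hc => hle (Submodule.subset_span hc)
    exact hφ (h φ (fun c hc => (hker c hc).ge) (hker e he))
  have hne : (interior (C : Set V)).Nonempty := by
    rw [hconv.interior_nonempty_iff_affineSpan_eq_top,
      AffineSubspace.affineSpan_eq_top_iff_vectorSpan_eq_top_of_nonempty ℝ V V ⟨0, C.zero_mem⟩,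
      eq_top_iff, ← hspan, Submodule.span_le]
    intro c hc
    simpa using vsub_mem_vectorSpan ℝ hc (show (0 : V) ∈ (C : Set V) from C.zero_mem)
  have hmem : e ∈ interior (C : Set V) := by
    by_contra hmem
    obtain ⟨φ, hφ⟩ := geometric_hahn_banach_open_point hconv.interior isOpen_interior hmem
    have hle : ∀ c ∈ C, φ c ≤ φ e := fun c hc => by
      have hc' : c ∈ closure (interior (C : Set V)) := by
        rw [hconv.closure_interior_eq_closure_of_nonempty_interior hne]
        exact subset_closure hc
      exact closure_minimal (fun a ha => (hφ a ha).le)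
        (isClosed_le φ.continuous continuous_const) hc'
    have hsm : ∀ c ∈ C, ∀ r : ℝ, 0 ≤ r → r * φ c ≤ φ e := fun c hc r hr => by
      simpa using hle _ (C.smul_mem hr hc)
    have hnonpos : ∀ c ∈ C, φ c ≤ 0 := fun c hc => by
      by_contra! hpos
      have := hsm c hc ((|φ e| + 1) / φ c) (by positivity)
      rw [div_mul_cancel₀ _ hpos.ne'] at this
      linarith [le_abs_self (φ e)]
    have he0 : φ e = 0 := le_antisymm (hnonpos e he) (by simpa using hle 0 C.zero_mem)
    have hz := h (-φ : V →L[ℝ] ℝ) (fun c hc => by simpa using hnonpos c hc) (by simp [he0])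
    obtain ⟨a, ha⟩ := hne
    have h1 := hφ a ha
    have h2 : -φ a = 0 := LinearMap.congr_fun hz a
    linarith
  have hev : ∀ᶠ t : ℝ in nhds 0, e + t • v ∈ (C : Set V) := by
    have hc : Filter.Tendsto (fun t : ℝ => e + t • v) (nhds 0) (nhds e) := by
      have : Continuous fun t : ℝ => e + t • v := by fun_prop
      simpa using this.tendsto 0
    exact hc.eventually (mem_interior_iff_mem_nhds.1 hmem)
  obtain ⟨t, ht, ht0⟩ := ((hev.filter_mono nhdsWithin_le_nhds).and
    (self_mem_nhdsWithin : Set.Ioi (0 : ℝ) ∈ nhdsWithin 0 (Set.Ioi 0))).exists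
  have ht0 : 0 < t := ht0
  refine ⟨t⁻¹, ?_⟩
  have := C.smul_mem (inv_nonneg.2 ht0.le) ht
  have h2 : t⁻¹ • (e + t • v) ∈ C := this
  rwa [smul_add, inv_smul_smul₀ ht0.ne'] at h2

section Truncation

open Matrix MvPolynomial
open scoped Kronecker

variable {n : ℕ} {ι : Type*} [Fintype ι]

theorem kronPow_posSemidef {M : Matrix ι ι ℝ} (hM : M.PosSemidef) (k : ℕ) :
    (kronPow M k).PosSemidef := by
  induction k with
  | zero =>
    have h : kronPow M 0 = 1 := by
      ext a b
      simp [kronPow, Subsingleton.elim a b, Matrix.one_apply]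
    exact h ▸ .one
  | succ k ih =>
    have h : kronPow M (k + 1) =
        (M ⊗ₖ kronPow M k).submatrix (fun a => (a 0, Fin.tail a)) (fun a => (a 0, Fin.tail a)) := by
      ext a b
      simp [kronPow, Fin.prod_univ_succ, Fin.tail]
    exact h ▸ (hM.kronecker ih).submatrix _

theorem eval_tipP_kronPow (G : Matrix ι ι (MvPolynomial (Fin n) ℝ)) (x : Fin n → ℝ) (k : ℕ)
    (Λ : Matrix (Fin k → ι) (Fin k → ι) ℝ) :
    eval x (tipP Λ (kronPow G k)) = ∑ i, ∑ j, Λ i j * kronPow (evalMat x G) k i j := by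
  simp [tipP, kronPow, evalMat]

theorem sum_sum_mul_nonneg_of_posSemidef {M N : Matrix ι ι ℝ} (hM : M.PosSemidef)
    (hN : N.PosSemidef) : 0 ≤ ∑ i, ∑ j, M i j * N i j := by
  simpa [dotProduct, mulVec] using (hM.hadamard hN).dotProduct_mulVec_nonneg 1

theorem eval_nonneg_of_mem_HsetT {G : Matrix ι ι (MvPolynomial (Fin n) ℝ)} {m : ℕ}
    {p : MvPolynomial (Fin n) ℝ} (hp : p ∈ HsetT G m) {x : Fin n → ℝ}
    (hx : (evalMat x G).PosSemidef) : 0 ≤ eval x p := by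
  obtain ⟨c, Λ, hc, hΛ, rfl⟩ := hp
  rw [map_add, eval_C, map_sum]
  refine add_nonneg hc (Finset.sum_nonneg fun k hk => ?_)
  rw [eval_tipP_kronPow]
  exact sum_sum_mul_nonneg_of_posSemidef (hΛ k hk) (kronPow_posSemidef hx k)

theorem tipP_zero (B : Matrix ι ι (MvPolynomial (Fin n) ℝ)) : tipP 0 B = 0 := by
  simp [tipP]

theorem tipP_add (Λ Λ' : Matrix ι ι ℝ) (B : Matrix ι ι (MvPolynomial (Fin n) ℝ)) :
    tipP (Λ + Λ') B = tipP Λ B + tipP Λ' B := by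
  simp [tipP, add_mul, Finset.sum_add_distrib]

theorem tipP_smul (c : ℝ) (Λ : Matrix ι ι ℝ) (B : Matrix ι ι (MvPolynomial (Fin n) ℝ)) :
    tipP (c • Λ) B = C c * tipP Λ B := by
  simp [tipP, Finset.mul_sum, mul_assoc]

theorem tipP_kronPow_mul (G : Matrix ι ι (MvPolynomial (Fin n) ℝ)) {k l : ℕ}
    (Λ : Matrix (Fin k → ι) (Fin k → ι) ℝ) (Λ' : Matrix (Fin l → ι) (Fin l → ι) ℝ) :
    tipP Λ (kronPow G k) * tipP Λ' (kronPow G l) =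
      tipP ((Λ ⊗ₖ Λ').submatrix (Fin.appendEquiv k l).symm (Fin.appendEquiv k l).symm)
        (kronPow G (k + l)) := by
  unfold tipP
  rw [← (Fin.appendEquiv k l).sum_comp, Fintype.sum_prod_type, Finset.sum_mul_sum]
  refine Finset.sum_congr rfl fun a _ => Finset.sum_congr rfl fun a' _ => ?_
  rw [← (Fin.appendEquiv k l).sum_comp, Fintype.sum_prod_type, Finset.sum_mul_sum]
  refine Finset.sum_congr rfl fun b _ => Finset.sum_congr rfl fun b' _ => ?_
  have happ : ∀ c c', Fin.appendEquiv (α := ι) k l (c, c') = Fin.append c c' := fun _ _ => rfl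
  have hsymm : ∀ c c', (Fin.appendEquiv (α := ι) k l).symm (Fin.append c c') = (c, c') :=
    fun c c' => (Fin.appendEquiv k l).symm_apply_apply (c, c')
  simp only [submatrix_apply, hsymm, kroneckerMap_apply, kronPow, of_apply,
    map_mul, Fin.prod_univ_add, happ, Fin.append_left, Fin.append_right]
  ring

theorem HsetT_mono (G : Matrix ι ι (MvPolynomial (Fin n) ℝ)) : Monotone (HsetT G) := by
  rintro m m' hm _ ⟨c, Λ, hc, hΛ, rfl⟩
  refine ⟨c, fun k => if k ≤ m then Λ k else 0, hc, fun k hk => ?_, ?_⟩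
  · rw [Finset.mem_Icc] at hk
    dsimp only
    split_ifs with h
    · exact hΛ k (Finset.mem_Icc.2 ⟨hk.1, h⟩)
    · exact .zero
  · congr 1
    rw [← Finset.sum_subset (Finset.Icc_subset_Icc_right hm)]
    · refine Finset.sum_congr rfl fun k hk => ?_
      simp only [if_pos (Finset.mem_Icc.1 hk).2]
    · intro k hk hk'
      rw [Finset.mem_Icc] at hk hk'
      have h : ¬k ≤ m := fun h => hk' ⟨hk.1, h⟩
      simp only [if_neg h, tipP_zero]

theorem C_mem_HsetT (G : Matrix ι ι (MvPolynomial (Fin n) ℝ)) {c : ℝ} (hc : 0 ≤ c) :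
    C c ∈ HsetT G 0 :=
  ⟨c, 0, hc, by simp, by simp⟩

theorem tipP_mem_HsetT (G : Matrix ι ι (MvPolynomial (Fin n) ℝ)) {k : ℕ} (hk : 1 ≤ k)
    {Λ : Matrix (Fin k → ι) (Fin k → ι) ℝ} (hΛ : Λ.PosSemidef) :
    tipP Λ (kronPow G k) ∈ HsetT G k := by
  refine ⟨0, Function.update 0 k Λ, le_rfl, fun j _ => ?_, ?_⟩
  · rcases eq_or_ne j k with rfl | h
    · rwa [Function.update_self]
    · rw [Function.update_of_ne h]
      exact .zero
  · rw [Finset.sum_eq_single_of_mem k (Finset.mem_Icc.2 ⟨hk, le_rfl⟩)]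
    · simp
    · intro j _ h
      rw [Function.update_of_ne h]
      exact tipP_zero _

theorem add_mem_HsetT {G : Matrix ι ι (MvPolynomial (Fin n) ℝ)} {m : ℕ}
    {p p' : MvPolynomial (Fin n) ℝ} (hp : p ∈ HsetT G m) (hp' : p' ∈ HsetT G m) :
    p + p' ∈ HsetT G m := by
  obtain ⟨c, Λ, hc, hΛ, rfl⟩ := hp
  obtain ⟨c', Λ', hc', hΛ', rfl⟩ := hp'
  refine ⟨c + c', Λ + Λ', add_nonneg hc hc', fun k hk => (hΛ k hk).add (hΛ' k hk), ?_⟩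
  simp only [Pi.add_apply, tipP_add, Finset.sum_add_distrib, C_add]
  ring

/-- The union of the truncations, as an additive submonoid. -/
def hsetAddSubmonoid (G : Matrix ι ι (MvPolynomial (Fin n) ℝ)) :
    AddSubmonoid (MvPolynomial (Fin n) ℝ) where
  carrier := {p | ∃ m, p ∈ HsetT G m}
  zero_mem' := ⟨0, by simpa using C_mem_HsetT G le_rfl⟩
  add_mem' := by
    rintro p r ⟨m, hm⟩ ⟨k, hk⟩
    exact ⟨max m k, add_mem_HsetT (HsetT_mono G (le_max_left _ _) hm)
      (HsetT_mono G (le_max_right _ _) hk)⟩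

/-- The union of the truncations, as a semiring. -/
def hsetSubsemiring (G : Matrix ι ι (MvPolynomial (Fin n) ℝ)) :
    Subsemiring (MvPolynomial (Fin n) ℝ) where
  __ := hsetAddSubmonoid G
  one_mem' := ⟨0, by simpa using C_mem_HsetT G zero_le_one⟩
  mul_mem' := by
    rintro _ _ ⟨m, c, Λ, hc, hΛ, rfl⟩ ⟨m', c', Λ', hc', hΛ', rfl⟩
    change _ ∈ hsetAddSubmonoid G
    rw [add_mul, mul_add, mul_add, Finset.sum_mul_sum, Finset.mul_sum, Finset.sum_mul, ← C_mul]
    refine add_mem (add_mem ⟨0, C_mem_HsetT G (mul_nonneg hc hc')⟩ (sum_mem fun k hk => ?_))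
      (add_mem (sum_mem fun k hk => ?_) (sum_mem fun k hk => sum_mem fun l hl => ?_))
    · rw [← tipP_smul]
      exact ⟨k, tipP_mem_HsetT G (Finset.mem_Icc.1 hk).1 ((hΛ' k hk).smul hc)⟩
    · rw [mul_comm, ← tipP_smul]
      exact ⟨k, tipP_mem_HsetT G (Finset.mem_Icc.1 hk).1 ((hΛ k hk).smul hc')⟩
    · rw [tipP_kronPow_mul]
      exact ⟨k + l, tipP_mem_HsetT G (le_add_right (Finset.mem_Icc.1 hk).1)
        (((hΛ k hk).kronecker (hΛ' l hl)).submatrix _)⟩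

theorem algebraMap_mem_hsetSubsemiring (G : Matrix ι ι (MvPolynomial (Fin n) ℝ)) {c : ℝ}
    (hc : 0 ≤ c) : algebraMap ℝ (MvPolynomial (Fin n) ℝ) c ∈ hsetSubsemiring G :=
  ⟨0, C_mem_HsetT G hc⟩

theorem tipP_mem_hsetSubsemiring (G : Matrix ι ι (MvPolynomial (Fin n) ℝ)) {Λ : Matrix ι ι ℝ}
    (hΛ : Λ.PosSemidef) : tipP Λ G ∈ hsetSubsemiring G := by
  have h : tipP Λ G = tipP (Λ.submatrix (Equiv.funUnique (Fin 1) ι) (Equiv.funUnique (Fin 1) ι))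
      (kronPow G 1) := by
    unfold tipP
    rw [← (Equiv.funUnique (Fin 1) ι).sum_comp]
    refine Finset.sum_congr rfl fun a _ => ?_
    rw [← (Equiv.funUnique (Fin 1) ι).sum_comp]
    simp [kronPow]
  exact ⟨1, h ▸ tipP_mem_HsetT G le_rfl (hΛ.submatrix _)⟩

end Truncation

section LinearMatrix

open Matrix MvPolynomial

variable {n q : ℕ} {A0 : Matrix (Fin q) (Fin q) ℝ} {A : Fin n → Matrix (Fin q) (Fin q) ℝ}

theorem evalMat_linMat (A0 : Matrix (Fin q) (Fin q) ℝ) (A : Fin n → Matrix (Fin q) (Fin q) ℝ)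
    (x : Fin n → ℝ) : evalMat x (linMat A0 A) = A0 + ∑ l, x l • A l := by
  ext i j
  simp [evalMat, linMat, Matrix.sum_apply]

theorem tipP_vecMulVec_linMat (A0 : Matrix (Fin q) (Fin q) ℝ)
    (A : Fin n → Matrix (Fin q) (Fin q) ℝ) (w : Fin q → ℝ) :
    tipP (vecMulVec w w) (linMat A0 A) =
      C (w ⬝ᵥ A0 *ᵥ w) + ∑ l, X l * C (w ⬝ᵥ A l *ᵥ w) := by
  refine MvPolynomial.funext fun x => ?_
  have h : ∀ M : Matrix (Fin q) (Fin q) ℝ,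
      w ⬝ᵥ M *ᵥ w = ∑ i, ∑ j, vecMulVec w w i j * M i j := fun M => by
    simp only [dotProduct, mulVec, vecMulVec_apply, Finset.mul_sum]
    exact Finset.sum_congr rfl fun i _ => Finset.sum_congr rfl fun j _ => by ring
  have h2 : eval x (tipP (vecMulVec w w) (linMat A0 A)) =
      w ⬝ᵥ evalMat x (linMat A0 A) *ᵥ w := by
    simp [h, tipP, evalMat]
  rw [h2, evalMat_linMat]
  simp [add_mulVec, sum_mulVec, smul_mulVec, dotProduct_add, dotProduct_sum]

theorem isSymm_sum_smul (hA : ∀ l, (A l).IsSymm) (x : Fin n → ℝ) :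
    (∑ l, x l • A l).IsSymm := by
  simp only [IsSymm, transpose_sum, transpose_smul, (hA _).eq]

theorem posSemidef_of_isSymm {M : Matrix (Fin q) (Fin q) ℝ} (hM : M.IsSymm)
    (h : ∀ w : Fin q → ℝ, 0 ≤ w ⬝ᵥ M *ᵥ w) : M.PosSemidef :=
  .of_dotProduct_mulVec_nonneg (by rwa [IsHermitian, conjTranspose_eq_transpose_of_trivial])
    fun w => by simpa using h w

/-- A bounded nonempty spectrahedron has no nonzero recession direction. -/
theorem eq_zero_of_posSemidef_sum_smul {x₀ v : Fin n → ℝ}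
    (hx₀ : (evalMat x₀ (linMat A0 A)).PosSemidef)
    (hbdd : Bornology.IsBounded {x | (evalMat x (linMat A0 A)).PosSemidef})
    (hv : (∑ l, v l • A l).PosSemidef) : v = 0 := by
  obtain ⟨r, hr⟩ := hbdd.exists_norm_le
  by_contra hne
  have hpos : 0 < ‖v‖ := norm_pos_iff.2 hne
  have hr0 : 0 ≤ r := (norm_nonneg _).trans (hr x₀ hx₀)
  set t : ℝ := (2 * r + 1) / ‖v‖ with ht
  have ht0 : 0 ≤ t := by positivity
  have hmem : (evalMat (x₀ + t • v) (linMat A0 A)).PosSemidef := by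
    have h : evalMat (x₀ + t • v) (linMat A0 A) =
        evalMat x₀ (linMat A0 A) + t • ∑ l, v l • A l := by
      simp only [evalMat_linMat, Pi.add_apply, Pi.smul_apply, smul_eq_mul, add_smul, mul_smul,
        Finset.sum_add_distrib, Finset.smul_sum, add_assoc]
    rw [h]
    exact hx₀.add (hv.smul ht0)
  have h1 : ‖t • v‖ = 2 * r + 1 := by
    rw [norm_smul, Real.norm_of_nonneg ht0, ht, div_mul_cancel₀ _ hpos.ne']
  have h2 : ‖t • v‖ ≤ ‖x₀ + t • v‖ + ‖x₀‖ := by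
    simpa using norm_sub_le (x₀ + t • v) x₀
  linarith [hr _ hmem, hr x₀ hx₀]

/-- The affine polynomials `b + ∑ aₗ xₗ` in the semiring of a linear matrix, as a cone of
coefficients `(a, b)`. -/
def affineCone (A0 : Matrix (Fin q) (Fin q) ℝ) (A : Fin n → Matrix (Fin q) (Fin q) ℝ) :
    PointedCone ℝ ((Fin n → ℝ) × ℝ) where
  carrier := {p | C p.2 + ∑ l, X l * C (p.1 l) ∈ hsetSubsemiring (linMat A0 A)}
  zero_mem' := by simp
  add_mem' := by
    intro p p' hp hp'
    have h := (hsetSubsemiring (linMat A0 A)).add_mem hp hp'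
    rw [Set.mem_ofPred_eq]
    convert h using 1
    simp only [Prod.snd_add, Prod.fst_add, Pi.add_apply, C_add, mul_add, Finset.sum_add_distrib]
    ring
  smul_mem' := by
    rintro ⟨c, hc⟩ p hp
    have h := (hsetSubsemiring (linMat A0 A)).mul_mem
      (algebraMap_mem_hsetSubsemiring (linMat A0 A) hc) hp
    change C (c * p.2) + ∑ l, X l * C (c * p.1 l) ∈ hsetSubsemiring (linMat A0 A)
    convert h using 1
    rw [algebraMap_eq]
    simp only [C_mul, mul_add, Finset.mul_sum]
    congr 1
    exact Finset.sum_congr rfl fun l _ => by ring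

theorem exists_smul_add_mem_affineCone (hA : ∀ l, (A l).IsSymm) {x₀ : Fin n → ℝ}
    (hx₀ : (evalMat x₀ (linMat A0 A)).PosSemidef)
    (hbdd : Bornology.IsBounded {x | (evalMat x (linMat A0 A)).PosSemidef})
    (v : (Fin n → ℝ) × ℝ) : ∃ N : ℝ, N • ((0, 1) : (Fin n → ℝ) × ℝ) + v ∈ affineCone A0 A := by
  refine exists_smul_add_mem_of_forall_eq_zero _ ?_ (fun φ hφ hφe => ?_) v
  · change C 1 + ∑ l : Fin n, X l * C (0 : ℝ) ∈ hsetSubsemiring (linMat A0 A)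
    simp
  have hφ_apply : ∀ p, φ p = ∑ l, φ (Pi.single l 1, 0) * p.1 l := by
    intro p
    have hp : p = ∑ l, p.1 l • ((Pi.single l 1, 0) : (Fin n → ℝ) × ℝ) +
        p.2 • ((0, 1) : (Fin n → ℝ) × ℝ) := by
      ext l
      · simp [Prod.fst_sum, Finset.sum_apply, Pi.single_apply]
      · simp [Prod.snd_sum]
    conv_lhs => rw [hp]
    simp only [map_add, map_sum, map_smul, hφe, smul_eq_mul, mul_zero, add_zero]
    exact Finset.sum_congr rfl fun l _ => mul_comm _ _
  have hzero : (fun l => φ (Pi.single l 1, 0)) = 0 := by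
    refine eq_zero_of_posSemidef_sum_smul hx₀ hbdd
      (posSemidef_of_isSymm (isSymm_sum_smul hA _) fun w => ?_)
    have hmem : ((fun l => w ⬝ᵥ A l *ᵥ w, w ⬝ᵥ A0 *ᵥ w) : (Fin n → ℝ) × ℝ) ∈ affineCone A0 A := by
      change C (w ⬝ᵥ A0 *ᵥ w) + ∑ l, X l * C (w ⬝ᵥ A l *ᵥ w) ∈ hsetSubsemiring (linMat A0 A)
      rw [← tipP_vecMulVec_linMat]
      exact tipP_mem_hsetSubsemiring _ (by simpa using posSemidef_vecMulVec_self_star w)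
    have h := hφ _ hmem
    rw [hφ_apply] at h
    simpa [sum_mulVec, smul_mulVec, dotProduct_sum] using h
  ext1
  all_goals
    refine LinearMap.ext fun p => ?_
    rw [LinearMap.comp_apply, hφ_apply]
    simp [congrFun hzero _]

theorem exists_algebraMap_add_mem_hsetSubsemiring (hA : ∀ l, (A l).IsSymm) {x₀ : Fin n → ℝ}
    (hx₀ : (evalMat x₀ (linMat A0 A)).PosSemidef)
    (hbdd : Bornology.IsBounded {x | (evalMat x (linMat A0 A)).PosSemidef})
    (p : MvPolynomial (Fin n) ℝ) :
    ∃ N : ℝ, algebraMap ℝ (MvPolynomial (Fin n) ℝ) N + p ∈ hsetSubsemiring (linMat A0 A) := by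
  have hX : ∀ (l : Fin n) (c : ℝ), ∃ N : ℝ, ∀ N' ≥ N,
      C N' + X l * C c ∈ hsetSubsemiring (linMat A0 A) := by
    intro l c
    obtain ⟨N, hN⟩ := exists_smul_add_mem_affineCone hA hx₀ hbdd (Pi.single l c, 0)
    refine ⟨N, fun N' hN' => ?_⟩
    have h := add_mem (algebraMap_mem_hsetSubsemiring (linMat A0 A) (sub_nonneg.2 hN')) hN
    convert h using 1
    have hsum : ∑ k, X k * C (Pi.single (M := fun _ : Fin n => ℝ) l c k) =
        (X l * C c : MvPolynomial (Fin n) ℝ) := by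
      rw [Finset.sum_eq_single l] <;> simp +contextual
    simp [algebraMap_eq, hsum]
    ring
  refine exists_algebraMap_add_mem_of_adjoin_eq_top
    (fun r hr => algebraMap_mem_hsetSubsemiring _ hr) adjoin_range_X ?_ p
  rintro _ ⟨l, rfl⟩
  obtain ⟨N, hN⟩ := hX l 1
  obtain ⟨M, hM⟩ := hX l (-1)
  refine ⟨max N M, ?_, ?_⟩
  · simpa [algebraMap_eq] using hN _ (le_max_left N M)
  · simpa [algebraMap_eq, sub_eq_add_neg] using hM _ (le_max_right N M)

/-- A polynomial that is nonnegative on a compact spectrahedron lies, up to an arbitrarily small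
positive constant, in one of the truncations. -/
theorem exists_add_C_mem_HsetT (hA0 : A0.IsSymm) (hA : ∀ l, (A l).IsSymm) {x₀ : Fin n → ℝ}
    (hx₀ : (evalMat x₀ (linMat A0 A)).PosSemidef)
    (hbdd : Bornology.IsBounded {x | (evalMat x (linMat A0 A)).PosSemidef})
    {p : MvPolynomial (Fin n) ℝ}
    (hp : ∀ x, (evalMat x (linMat A0 A)).PosSemidef → 0 ≤ eval x p) {ε : ℝ} (hε : 0 < ε) :
    ∃ m, p + C ε ∈ HsetT (linMat A0 A) m := by
  refine add_algebraMap_mem_of_forall_algHom_nonneg (T := hsetSubsemiring (linMat A0 A))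
    (fun r hr => algebraMap_mem_hsetSubsemiring _ hr)
    (exists_algebraMap_add_mem_hsetSubsemiring hA hx₀ hbdd) (fun χ hχ => ?_) hε
  have hχ_eval : ∀ p, χ p = eval (fun l => χ (X l)) p := fun p => by
    rw [← aeval_eq_eval]
    exact DFunLike.congr_fun (aeval_unique χ) p
  rw [hχ_eval]
  refine hp _ (posSemidef_of_isSymm ?_ fun w => ?_)
  · rw [evalMat_linMat]
    exact hA0.add (isSymm_sum_smul hA _)
  · have h := hχ _ (tipP_mem_hsetSubsemiring (linMat A0 A)
      (by simpa using posSemidef_vecMulVec_self_star w : (vecMulVec w w).PosSemidef))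
    rw [tipP_vecMulVec_linMat, hχ_eval] at h
    rw [evalMat_linMat]
    simpa [add_mulVec, sum_mulVec, smul_mulVec, dotProduct_add, dotProduct_sum] using h

end LinearMatrix

/-- **Convergence of the SDP relaxations (linear case).**
Let `K = {x : G(x) := A₀ + ∑ xₗ Aₗ ⪰ 0}` be compact with nonempty interior, let
`f* = min_{x ∈ K} f(x)` and for each `m` let
`f*_m = sup {r : f − r ∈ H_m(G)}` (an extended real, `sup ∅ = ⊥`).  Then `(f*_m)` is
nondecreasing, `f*_m ≤ f*` for all `m`, and `f*_m → f*` as `m → ∞`. -/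
theorem sdp_relaxation_convergence {n q : ℕ}
    (A0 : Matrix (Fin q) (Fin q) ℝ) (A : Fin n → Matrix (Fin q) (Fin q) ℝ)
    (hA0 : A0.IsSymm) (hA : ∀ l, (A l).IsSymm)
    (K : Set (Fin n → ℝ))
    (hK : K = {x | (evalMat x (linMat A0 A)).PosSemidef})
    (hcomp : IsCompact K)
    (hint : (interior K).Nonempty)
    (f : MvPolynomial (Fin n) ℝ) (fstar : ℝ)
    (hfstar : IsLeast {y : ℝ | ∃ x ∈ K, y = MvPolynomial.eval x f} fstar)
    (fm : ℕ → EReal)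
    (hfm : ∀ m, fm m = sSup {z : EReal | ∃ r : ℝ, z = (r : EReal) ∧
      f - MvPolynomial.C r ∈ HsetT (linMat A0 A) m}) :
    Monotone fm ∧ (∀ m, fm m ≤ (fstar : EReal)) ∧
      Filter.Tendsto fm Filter.atTop (nhds (fstar : EReal)) := by
  have hmono : Monotone fm := fun m m' h => by
    rw [hfm, hfm]
    exact sSup_le_sSup fun z ⟨r, hz, hr⟩ => ⟨r, hz, HsetT_mono _ h hr⟩
  obtain ⟨⟨x₀, hx₀, hfx₀⟩, hmin⟩ := hfstar
  subst hK
  have hle : ∀ m, fm m ≤ (fstar : EReal) := fun m => by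
    rw [hfm]
    refine sSup_le ?_
    rintro _ ⟨r, rfl, hr⟩
    have h := eval_nonneg_of_mem_HsetT hr hx₀
    rw [map_sub, MvPolynomial.eval_C, ← hfx₀] at h
    exact EReal.coe_le_coe_iff.2 (sub_nonneg.1 h)
  refine ⟨hmono, hle, tendsto_order.2 ⟨fun a ha => ?_, fun a ha =>
    Filter.Eventually.of_forall fun m => (hle m).trans_lt ha⟩⟩
  obtain ⟨r, har, hr⟩ := EReal.lt_iff_exists_real_btwn.1 ha
  obtain ⟨m, hm⟩ := exists_add_C_mem_HsetT hA0 hA hx₀ hcomp.isBounded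
    (p := f - MvPolynomial.C fstar)
    (fun x hx => by
      rw [map_sub, MvPolynomial.eval_C]
      exact sub_nonneg.2 (hmin ⟨x, hx, rfl⟩))
    (sub_pos.2 (EReal.coe_lt_coe_iff.1 hr))
  filter_upwards [Filter.eventually_ge_atTop m] with m' hm'
  refine har.trans_le (le_trans ?_ (hmono hm'))
  rw [hfm]
  refine le_sSup ⟨r, rfl, ?_⟩
  convert hm using 1
  rw [MvPolynomial.C_sub]
  ring

end
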